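/- With the notation of the finite normal-mode expansion, for every integer n ≥ 1: ∫_{−H}^0 B(u,v,w;v)(z)·U_n(z) dz = (1/√H)·(u_0·v^x_n + v_0·v^y_n + u_n·v^x_0 + v_n·v^y_0) + (1/√(2H))·[ Σ_{m=1}^{n−1} (u_{n−m}·v^x_m + v_{n−m}·v^y_m) + Σ_{m≥n+1} (u_{m−n}·v^x_m + v_{m−n}·v^y_m) + Σ_{m≥1} (u_{m+n}·v^x_m + v_{m+n}·v^y_m) ] − (1/√(2H))·[ Σ_{m≥n+1} λ_m·w_{m−n}·v_m + Σ_{m≥1} λ_m·w_{m+n}·v_m − Σ_{m=1}^{n−1} λ_m·w_{n−m}·v_m ] (all sums are finite since coefficients with index > M vanish). -/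

import Mathlib

/-- The eigenvalue `λ_n = nπ/H`. -/
noncomputable def lamC (H : ℝ) (n : ℕ) : ℝ := n * Real.pi / H

/-- The cosine normal-mode eigenfunctions: `U_0(z) = 1/√H`,
`U_n(z) = √(2/H)·cos(λ_n z)` for `n ≥ 1`. -/
noncomputable def Ue (H : ℝ) (n : ℕ) (z : ℝ) : ℝ :=
  if n = 0 then 1 / Real.sqrt H else Real.sqrt (2 / H) * Real.cos (lamC H n * z)

/-- The sine normal-mode eigenfunctions: `W_n(z) = √(2/H)·sin(λ_n z)`. -/
noncomputable def We (H : ℝ) (n : ℕ) (z : ℝ) : ℝ :=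
  Real.sqrt (2 / H) * Real.sin (lamC H n * z)

/-- Finite cosine-mode expansion `Σ_{m=0}^M U_m(z)·c_m`. -/
noncomputable def cosExp (H : ℝ) (M : ℕ) (c : ℕ → ℝ) (z : ℝ) : ℝ :=
  ∑ m ∈ Finset.range (M + 1), Ue H m z * c m

/-- Finite sine-mode expansion `Σ_{m=1}^M W_m(z)·c_m`. -/
noncomputable def sinExp (H : ℝ) (M : ℕ) (c : ℕ → ℝ) (z : ℝ) : ℝ :=
  ∑ m ∈ Finset.Icc 1 M, We H m z * c m

/-- `z`-derivative of the cosine-mode expansion: `−Σ_{m=1}^M λ_m W_m(z)·c_m`. -/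
noncomputable def dzCosExp (H : ℝ) (M : ℕ) (c : ℕ → ℝ) (z : ℝ) : ℝ :=
  -∑ m ∈ Finset.Icc 1 M, lamC H m * We H m z * c m

/-- `z`-derivative of the sine-mode expansion: `Σ_{m=1}^M λ_m U_m(z)·c_m`. -/
noncomputable def dzSinExp (H : ℝ) (M : ℕ) (c : ℕ → ℝ) (z : ℝ) : ℝ :=
  ∑ m ∈ Finset.Icc 1 M, lamC H m * Ue H m z * c m

lemma int_cos (H : ℝ) (hH : 0 < H) (j : ℤ) :
    (∫ z in (-H)..0, Real.cos ((j : ℝ) * Real.pi / H * z)) = if j = 0 then H else 0 := by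
  split_ifs with h
  · subst h; simp
  · have hj : (j : ℝ) ≠ 0 := by exact_mod_cast h
    have hc : (j : ℝ) * Real.pi / H ≠ 0 := by
      have := Real.pi_ne_zero
      positivity
    rw [intervalIntegral.integral_comp_mul_left (fun x => Real.cos x) hc, integral_cos]
    have : (j : ℝ) * Real.pi / H * (-H) = -(j * Real.pi) := by field_simp
    rw [this, mul_zero, Real.sin_zero, Real.sin_neg, Real.sin_int_mul_pi]
    simp

lemma ii_cos (H a : ℝ) :
    IntervalIntegrable (fun z => Real.cos (a * z)) MeasureTheory.volume (-H) 0 :=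
  (by fun_prop : Continuous (fun z => Real.cos (a * z))).intervalIntegrable _ _

lemma int_cc (H : ℝ) (hH : 0 < H) (m n : ℕ) (hn : 1 ≤ n) :
    (∫ z in (-H)..0, Real.cos (lamC H m * z) * Real.cos (lamC H n * z))
      = if m = n then H / 2 else 0 := by
  have e : (fun z => Real.cos (lamC H m * z) * Real.cos (lamC H n * z)) = fun z =>
      (1/2) * (Real.cos ((((m:ℤ) + n : ℤ) : ℝ) * Real.pi / H * z)
        + Real.cos ((((m:ℤ) - n : ℤ) : ℝ) * Real.pi / H * z)) := by
    funext z
    have h1 : (((m:ℤ) + n : ℤ) : ℝ) * Real.pi / H * z = lamC H m * z + lamC H n * z := by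
      simp only [lamC]; push_cast; ring
    have h2 : (((m:ℤ) - n : ℤ) : ℝ) * Real.pi / H * z = lamC H m * z - lamC H n * z := by
      simp only [lamC]; push_cast; ring
    rw [h1, h2, Real.cos_add, Real.cos_sub]; ring
  rw [e, intervalIntegral.integral_const_mul,
    intervalIntegral.integral_add (ii_cos _ _) (ii_cos _ _), int_cos H hH, int_cos H hH]
  have a1 : ¬ ((m:ℤ) + n = 0) := by omega
  have a2 : ((m:ℤ) - n = 0) ↔ m = n := by omega
  simp only [a1, a2, if_false]
  split_ifs <;> ring

lemma int_ccc (H : ℝ) (hH : 0 < H) (k m n : ℕ) (hn : 1 ≤ n) :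
    (∫ z in (-H)..0, Real.cos (lamC H k * z) * Real.cos (lamC H m * z) * Real.cos (lamC H n * z))
      = H / 4 * ((if k + m = n then 1 else 0) + (if k + n = m then 1 else 0)
          + (if k = m + n then 1 else 0)) := by
  have e : (fun z => Real.cos (lamC H k * z) * Real.cos (lamC H m * z) * Real.cos (lamC H n * z))
      = fun z => (1/2) * (Real.cos (lamC H (k + m) * z) * Real.cos (lamC H n * z))
        + (1/4) * (Real.cos ((((k:ℤ) - m + n : ℤ) : ℝ) * Real.pi / H * z)
        + Real.cos ((((k:ℤ) - m - n : ℤ) : ℝ) * Real.pi / H * z)) := by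
    funext z
    have h0 : lamC H (k + m) * z = lamC H k * z + lamC H m * z := by
      simp only [lamC]; push_cast; ring
    have h1 : (((k:ℤ) - m + n : ℤ) : ℝ) * Real.pi / H * z
        = (lamC H k * z - lamC H m * z) + lamC H n * z := by
      simp only [lamC]; push_cast; ring
    have h2 : (((k:ℤ) - m - n : ℤ) : ℝ) * Real.pi / H * z
        = (lamC H k * z - lamC H m * z) - lamC H n * z := by
      simp only [lamC]; push_cast; ring
    rw [h0, h1, h2, Real.cos_add _ (lamC H n * z), Real.cos_sub _ (lamC H n * z), Real.cos_add,
      Real.cos_sub]; ring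
  rw [e, intervalIntegral.integral_add
      ((by fun_prop : Continuous _).intervalIntegrable _ _)
      ((by fun_prop : Continuous _).intervalIntegrable _ _),
    intervalIntegral.integral_const_mul, intervalIntegral.integral_const_mul,
    intervalIntegral.integral_add (ii_cos _ _) (ii_cos _ _), int_cos H hH, int_cos H hH,
    int_cc H hH _ _ hn]
  have a1 : ((k:ℤ) - m + n = 0) ↔ k + n = m := by omega
  have a2 : ((k:ℤ) - m - n = 0) ↔ k = m + n := by omega
  simp only [a1, a2]
  split_ifs <;> ring

lemma int_ssc (H : ℝ) (hH : 0 < H) (k m n : ℕ) (hn : 1 ≤ n) :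
    (∫ z in (-H)..0, Real.sin (lamC H k * z) * Real.sin (lamC H m * z) * Real.cos (lamC H n * z))
      = H / 4 * ((if k + n = m then 1 else 0)
          + (if k = m + n then 1 else 0) - (if k + m = n then 1 else 0)) := by
  have e : (fun z => Real.sin (lamC H k * z) * Real.sin (lamC H m * z) * Real.cos (lamC H n * z))
      = fun z => Real.cos (lamC H k * z) * Real.cos (lamC H m * z) * Real.cos (lamC H n * z)
        - Real.cos (lamC H (k + m) * z) * Real.cos (lamC H n * z) := by
    funext z
    have h0 : lamC H (k + m) * z = lamC H k * z + lamC H m * z := by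
      simp only [lamC]; push_cast; ring
    rw [h0, Real.cos_add]; ring
  rw [e, intervalIntegral.integral_sub
      ((by fun_prop : Continuous _).intervalIntegrable _ _)
      ((by fun_prop : Continuous _).intervalIntegrable _ _),
    int_ccc H hH _ _ _ hn, int_cc H hH _ _ hn]
  split_ifs <;> ring

lemma coef3 (H : ℝ) (hH : 0 < H) :
    Real.sqrt (2 / H) * Real.sqrt (2 / H) * Real.sqrt (2 / H) * (H / 4)
      = 1 / Real.sqrt (2 * H) := by
  rw [Real.mul_self_sqrt (by positivity), Real.sqrt_div (by norm_num), Real.sqrt_mul (by norm_num)]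
  have h2 : Real.sqrt 2 ≠ 0 := by positivity
  have h3 : Real.sqrt H ≠ 0 := by positivity
  have h4 : Real.sqrt 2 ^ 2 = 2 := Real.sq_sqrt (by norm_num)
  field_simp
  nlinarith [h4]

lemma coef2 (H : ℝ) (hH : 0 < H) :
    Real.sqrt (2 / H) * Real.sqrt (2 / H) * (H / 2) = 1 := by
  rw [Real.mul_self_sqrt (by positivity)]
  field_simp

lemma Ue_cont (H : ℝ) (n : ℕ) : Continuous (Ue H n) := by
  unfold Ue
  split_ifs <;> fun_prop

lemma We_cont (H : ℝ) (n : ℕ) : Continuous (We H n) := by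
  unfold We
  fun_prop

lemma int_UUU (H : ℝ) (hH : 0 < H) (k m n : ℕ) (hn : 1 ≤ n) :
    (∫ z in (-H)..0, Ue H k z * Ue H m z * Ue H n z)
      = 1 / Real.sqrt H * ((if m = n then (if k = 0 then 1 else 0) else 0)
          + (if m = 0 then (if k = n then 1 else 0) else 0))
        + 1 / Real.sqrt (2 * H) * ((if 1 ≤ m ∧ m < n then (if k = n - m then 1 else 0) else 0)
          + (if n + 1 ≤ m then (if k = m - n then 1 else 0) else 0)
          + (if 1 ≤ m then (if k = m + n then 1 else 0) else 0)) := by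
  have hn0 : n ≠ 0 := by omega
  have h2 := coef2 H hH
  have h3 := coef3 H hH
  rcases Nat.eq_zero_or_pos k with hk | hk
  · subst hk
    rcases Nat.eq_zero_or_pos m with hm | hm
    · subst hm
      have e : (fun z => Ue H 0 z * Ue H 0 z * Ue H n z) = fun z =>
          (1 / Real.sqrt H * (1 / Real.sqrt H) * Real.sqrt (2 / H)) *
            (Real.cos (lamC H 0 * z) * Real.cos (lamC H n * z)) := by
        funext z; simp [Ue, hn0, lamC]; ring
      rw [e, intervalIntegral.integral_const_mul, int_cc H hH _ _ hn]
      simp [hn0, hn0.symm]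
    · have hm0 : m ≠ 0 := by omega
      have e : (fun z => Ue H 0 z * Ue H m z * Ue H n z) = fun z =>
          (1 / Real.sqrt H * (Real.sqrt (2 / H) * Real.sqrt (2 / H))) *
            (Real.cos (lamC H m * z) * Real.cos (lamC H n * z)) := by
        funext z; simp only [Ue, hn0, hm0, if_true, if_false]; ring
      rw [e, intervalIntegral.integral_const_mul, int_cc H hH _ _ hn]
      have b1 : ¬ (0 = m + n) := by omega
      by_cases hmn : m = n
      · subst hmn
        rw [if_pos rfl, mul_assoc, h2]
        simp [hm0]
        omega
      · have b2 : 1 ≤ m ∧ m < n → ¬ (0 = n - m) := by omega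
        have b3 : n + 1 ≤ m → ¬ (0 = m - n) := by omega
        simp only [hmn, hm0, b1, if_false]
        split_ifs <;> first | omega | simp
  · have hk0 : k ≠ 0 := by omega
    rcases Nat.eq_zero_or_pos m with hm | hm
    · subst hm
      have e : (fun z => Ue H k z * Ue H 0 z * Ue H n z) = fun z =>
          (1 / Real.sqrt H * (Real.sqrt (2 / H) * Real.sqrt (2 / H))) *
            (Real.cos (lamC H k * z) * Real.cos (lamC H n * z)) := by
        funext z; simp only [Ue, hn0, hk0, if_true, if_false]; ring
      rw [e, intervalIntegral.integral_const_mul, int_cc H hH _ _ hn]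
      by_cases hmn : k = n
      · subst hmn
        rw [if_pos rfl, mul_assoc, h2]
        simp [hk0]
      · simp [hmn, hk0]
    · have hm0 : m ≠ 0 := by omega
      have e : (fun z => Ue H k z * Ue H m z * Ue H n z) = fun z =>
          (Real.sqrt (2 / H) * Real.sqrt (2 / H) * Real.sqrt (2 / H)) *
            (Real.cos (lamC H k * z) * Real.cos (lamC H m * z) * Real.cos (lamC H n * z)) := by
        funext z; simp only [Ue, hn0, hk0, hm0, if_false]; ring
      rw [e, intervalIntegral.integral_const_mul, int_ccc H hH _ _ _ hn, ← mul_assoc, h3]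
      simp only [hk0, hm0, if_false, ← ite_and]
      have b1 : ((1 ≤ m ∧ m < n) ∧ k = n - m) ↔ k + m = n := by omega
      have b2 : (n + 1 ≤ m ∧ k = m - n) ↔ k + n = m := by omega
      have b3 : (1 ≤ m ∧ k = m + n) ↔ k = m + n := by omega
      simp only [b1, b2, b3]
      simp

lemma int_WWU (H : ℝ) (hH : 0 < H) (k m n : ℕ) (hn : 1 ≤ n) :
    (∫ z in (-H)..0, We H k z * We H m z * Ue H n z)
      = 1 / Real.sqrt (2 * H) * (
          (if n + 1 ≤ m then (if k = m - n then 1 else 0) else 0)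
          + (if 1 ≤ m then (if k = m + n then 1 else 0) else 0)
          - (if 1 ≤ m ∧ m < n then (if k = n - m then 1 else 0) else 0)) := by
  have hn0 : n ≠ 0 := by omega
  have h3 := coef3 H hH
  have e : (fun z => We H k z * We H m z * Ue H n z) = fun z =>
      (Real.sqrt (2 / H) * Real.sqrt (2 / H) * Real.sqrt (2 / H)) *
        (Real.sin (lamC H k * z) * Real.sin (lamC H m * z) * Real.cos (lamC H n * z)) := by
    funext z; simp only [Ue, We, hn0, if_false]; ring
  rw [e, intervalIntegral.integral_const_mul, int_ssc H hH _ _ _ hn, ← mul_assoc, h3]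
  congr 1
  simp only [← ite_and]
  split_ifs <;> first | omega | norm_num

lemma sum_ind (M : ℕ) (c : ℕ → ℝ) (hc : ∀ m, M < m → c m = 0) (j : ℕ) :
    ∑ k ∈ Finset.range (M + 1), c k * (if k = j then 1 else 0) = c j := by
  simp only [mul_ite, mul_one, mul_zero, Finset.sum_ite_eq', Finset.mem_range]
  split_ifs with h
  · rfl
  · exact (hc j (by omega)).symm

lemma sum_ind' (M : ℕ) (c : ℕ → ℝ) (hc : ∀ m, M < m → c m = 0) (j : ℕ) (P : Prop) [Decidable P] :
    ∑ k ∈ Finset.range (M + 1), c k * (if P then (if k = j then 1 else 0) else 0)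
      = if P then c j else 0 := by
  split_ifs
  · exact sum_ind M c hc j
  · simp

lemma tsum_to_range (M : ℕ) (f : ℕ → ℝ) (hf : ∀ m, M < m → f m = 0) :
    ∑' m, f m = ∑ m ∈ Finset.range (M + 1), f m :=
  tsum_eq_sum (fun m hm => hf m (by simpa using hm))

lemma ico_range (M n : ℕ) (f : ℕ → ℝ) (hf : ∀ m, M < m → f m = 0) :
    ∑ m ∈ Finset.Ico 1 n, f m
      = ∑ m ∈ Finset.range (M + 1), if 1 ≤ m ∧ m < n then f m else 0 := by
  rw [← tsum_to_range M _ (fun m hm => by rw [hf m hm]; simp),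
    tsum_eq_sum (s := Finset.Ico 1 n) (fun m hm => if_neg (by simpa using hm))]
  exact Finset.sum_congr rfl (fun m hm => (if_pos (by simpa using hm)).symm)

/-- Expansion of the integral of a product of finite sums. -/
lemma int_expand (H : ℝ) (M : ℕ) (c d : ℕ → ℝ) (F G : ℕ → ℝ → ℝ) (K : ℝ → ℝ)
    (hF : ∀ k, Continuous (F k)) (hG : ∀ k, Continuous (G k)) (hK : Continuous K) :
    (∫ z in (-H)..0, (∑ k ∈ Finset.range (M + 1), F k z * c k) *
        (∑ m ∈ Finset.range (M + 1), G m z * d m) * K z)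
      = ∑ m ∈ Finset.range (M + 1), (∑ k ∈ Finset.range (M + 1),
          c k * ∫ z in (-H)..0, F k z * G m z * K z) * d m := by
  have e : (fun z => (∑ k ∈ Finset.range (M + 1), F k z * c k) *
        (∑ m ∈ Finset.range (M + 1), G m z * d m) * K z) = fun z =>
      ∑ m ∈ Finset.range (M + 1), ∑ k ∈ Finset.range (M + 1),
          (c k * d m) * (F k z * G m z * K z) := by
    funext z
    rw [Finset.sum_mul_sum, Finset.sum_comm, Finset.sum_mul]
    refine Finset.sum_congr rfl (fun m _ => ?_)
    rw [Finset.sum_mul]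
    exact Finset.sum_congr rfl (fun k _ => by ring)
  rw [e, intervalIntegral.integral_finsetSum (fun m _ =>
    (by fun_prop : Continuous _).intervalIntegrable _ _)]
  refine Finset.sum_congr rfl (fun m _ => ?_)
  rw [intervalIntegral.integral_finsetSum (fun m _ =>
    (by fun_prop : Continuous _).intervalIntegrable _ _), Finset.sum_mul]
  refine Finset.sum_congr rfl (fun k _ => ?_)
  rw [intervalIntegral.integral_const_mul]; ring

lemma proj_cos (H : ℝ) (hH : 0 < H) (M : ℕ) (c d : ℕ → ℝ)
    (hc : ∀ m, M < m → c m = 0) (hd : ∀ m, M < m → d m = 0) (n : ℕ) (hn : 1 ≤ n) :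
    (∫ z in (-H)..0, cosExp H M c z * cosExp H M d z * Ue H n z)
      = 1 / Real.sqrt H * (c 0 * d n + c n * d 0)
        + 1 / Real.sqrt (2 * H) *
          ((∑ m ∈ Finset.range (M + 1), if 1 ≤ m ∧ m < n then c (n - m) * d m else 0)
          + (∑ m ∈ Finset.range (M + 1), if n + 1 ≤ m then c (m - n) * d m else 0)
          + (∑ m ∈ Finset.range (M + 1), if 1 ≤ m then c (m + n) * d m else 0)) := by
  unfold cosExp
  rw [int_expand H M c d (Ue H) (Ue H) (Ue H n) (Ue_cont H) (Ue_cont H) (Ue_cont H n)]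
  have key : ∀ m, (∑ k ∈ Finset.range (M + 1),
      c k * ∫ z in (-H)..0, Ue H k z * Ue H m z * Ue H n z) * d m =
      1 / Real.sqrt H * (c 0 * (d m * (if m = n then 1 else 0))
        + c n * (d m * (if m = 0 then 1 else 0)))
      + 1 / Real.sqrt (2 * H) * ((if 1 ≤ m ∧ m < n then c (n - m) * d m else 0)
        + (if n + 1 ≤ m then c (m - n) * d m else 0)
        + (if 1 ≤ m then c (m + n) * d m else 0)) := by
    intro m
    simp only [int_UUU H hH _ _ _ hn]
    simp only [mul_add, mul_left_comm (c _), Finset.sum_add_distrib, ← Finset.mul_sum,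
      sum_ind' M c hc]
    split_ifs <;> ring
  simp only [key, Finset.sum_add_distrib, ← Finset.mul_sum, sum_ind M d hd]

lemma proj_sin (H : ℝ) (hH : 0 < H) (M : ℕ) (c d : ℕ → ℝ)
    (hc : ∀ m, M < m → c m = 0) (n : ℕ) (hn : 1 ≤ n) :
    (∫ z in (-H)..0, sinExp H M c z * dzCosExp H M d z * Ue H n z)
      = - (1 / Real.sqrt (2 * H) *
          ((∑ m ∈ Finset.range (M + 1), if n + 1 ≤ m then lamC H m * c (m - n) * d m else 0)
          + (∑ m ∈ Finset.range (M + 1), if 1 ≤ m then lamC H m * c (m + n) * d m else 0)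
          - (∑ m ∈ Finset.range (M + 1),
              if 1 ≤ m ∧ m < n then lamC H m * c (n - m) * d m else 0))) := by
  have hI : ∀ f : ℕ → ℝ, f 0 = 0 →
      ∑ m ∈ Finset.Icc 1 M, f m = ∑ m ∈ Finset.range (M + 1), f m := by
    intro f hf
    refine Finset.sum_subset (fun m hm => ?_) (fun m hm hm' => ?_)
    · simp at hm ⊢; omega
    · simp at hm hm'
      have : m = 0 := by omega
      rw [this, hf]
  have e1 : ∀ z, sinExp H M c z * dzCosExp H M d z * Ue H n z =
      -((∑ k ∈ Finset.range (M + 1), We H k z * c k) *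
        (∑ m ∈ Finset.range (M + 1), We H m z * (lamC H m * d m)) * Ue H n z) := by
    intro z
    unfold sinExp dzCosExp
    rw [hI _ (by simp [We, lamC]), hI _ (by simp [We, lamC])]
    rw [Finset.sum_congr rfl (fun m _ => (by ring :
      lamC H m * We H m z * d m = We H m z * (lamC H m * d m)))]
    ring
  simp only [e1]
  rw [intervalIntegral.integral_neg, int_expand H M c (fun m => lamC H m * d m) (We H) (We H)
    (Ue H n) (We_cont H) (We_cont H) (Ue_cont H n)]
  have key : ∀ m, (∑ k ∈ Finset.range (M + 1),
      c k * ∫ z in (-H)..0, We H k z * We H m z * Ue H n z) * (lamC H m * d m) =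
      1 / Real.sqrt (2 * H) * (
        (if n + 1 ≤ m then lamC H m * c (m - n) * d m else 0)
        + (if 1 ≤ m then lamC H m * c (m + n) * d m else 0)
        - (if 1 ≤ m ∧ m < n then lamC H m * c (n - m) * d m else 0)) := by
    intro m
    simp only [int_WWU H hH _ _ _ hn]
    simp only [mul_add, mul_sub, mul_left_comm (c _), Finset.sum_add_distrib,
      Finset.sum_sub_distrib, ← Finset.mul_sum, sum_ind' M c hc]
    split_ifs <;> ring
  simp only [key, Finset.sum_add_distrib, Finset.sum_sub_distrib, ← Finset.mul_sum]

lemma cosExp_cont (H : ℝ) (M : ℕ) (c : ℕ → ℝ) : Continuous (cosExp H M c) := by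
  have := Ue_cont H
  unfold cosExp
  fun_prop

lemma sinExp_cont (H : ℝ) (M : ℕ) (c : ℕ → ℝ) : Continuous (sinExp H M c) := by
  have := We_cont H
  unfold sinExp
  fun_prop

lemma dzCosExp_cont (H : ℝ) (M : ℕ) (c : ℕ → ℝ) : Continuous (dzCosExp H M c) := by
  have := We_cont H
  unfold dzCosExp
  fun_prop

/-- Projection of the nonlinear term `B(u,v,w;v) = u·v_x + v·v_y + w·v_z` onto the
baroclinic mode `U_n`, `n ≥ 1`.  Here `uc, vc, vcx, vcy, wc` are the normal-mode
coefficients (at a fixed point) of `u, v, ∂v/∂x, ∂v/∂y, w`, all vanishing above `M`. -/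
theorem B_v_proj_n (H : ℝ) (hH : 0 < H) (M : ℕ) (hM : 1 ≤ M)
    (uc vc vcx vcy wc : ℕ → ℝ)
    (huc : ∀ m, M < m → uc m = 0) (hvc : ∀ m, M < m → vc m = 0)
    (hvcx : ∀ m, M < m → vcx m = 0) (hvcy : ∀ m, M < m → vcy m = 0)
    (hwc : ∀ m, M < m → wc m = 0)
    (n : ℕ) (hn : 1 ≤ n) :
    (∫ z in (-H)..0,
        (cosExp H M uc z * cosExp H M vcx z + cosExp H M vc z * cosExp H M vcy z +
          sinExp H M wc z * dzCosExp H M vc z) * Ue H n z)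
      = (1 / Real.sqrt H) *
          (uc 0 * vcx n + vc 0 * vcy n + uc n * vcx 0 + vc n * vcy 0)
        + (1 / Real.sqrt (2 * H)) *
          ((∑ m ∈ Finset.Ico 1 n, (uc (n - m) * vcx m + vc (n - m) * vcy m))
            + (∑' m : ℕ, if n + 1 ≤ m then uc (m - n) * vcx m + vc (m - n) * vcy m else 0)
            + (∑' m : ℕ, if 1 ≤ m then uc (m + n) * vcx m + vc (m + n) * vcy m else 0))
        - (1 / Real.sqrt (2 * H)) *
          ((∑' m : ℕ, if n + 1 ≤ m then lamC H m * wc (m - n) * vc m else 0)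
            + (∑' m : ℕ, if 1 ≤ m then lamC H m * wc (m + n) * vc m else 0)
            - (∑ m ∈ Finset.Ico 1 n, lamC H m * wc (n - m) * vc m)) := by
  have q1 := cosExp_cont H M uc
  have q2 := cosExp_cont H M vcx
  have q3 := cosExp_cont H M vc
  have q4 := cosExp_cont H M vcy
  have q5 := sinExp_cont H M wc
  have q6 := dzCosExp_cont H M vc
  have q7 := Ue_cont H n
  simp only [add_mul]
  rw [intervalIntegral.integral_add
      ((by fun_prop : Continuous _).intervalIntegrable _ _)
      ((by fun_prop : Continuous _).intervalIntegrable _ _),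
    intervalIntegral.integral_add
      ((by fun_prop : Continuous _).intervalIntegrable _ _)
      ((by fun_prop : Continuous _).intervalIntegrable _ _),
    proj_cos H hH M uc vcx huc hvcx n hn, proj_cos H hH M vc vcy hvc hvcy n hn,
    proj_sin H hH M wc vc hwc n hn]
  rw [tsum_to_range M _ (fun m hm => by simp [hvcx m hm, hvcy m hm]),
    tsum_to_range M _ (fun m hm => by simp [hvcx m hm, hvcy m hm]),
    tsum_to_range M _ (fun m hm => by simp [hvc m hm]),
    tsum_to_range M _ (fun m hm => by simp [hvc m hm]),
    ico_range M n _ (fun m hm => by simp [hvcx m hm, hvcy m hm]),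
    ico_range M n _ (fun m hm => by simp [hvc m hm])]
  have hs : ∀ (P : ℕ → Prop) [DecidablePred P] (f g : ℕ → ℝ),
      (∑ m ∈ Finset.range (M + 1), if P m then f m + g m else 0)
        = (∑ m ∈ Finset.range (M + 1), if P m then f m else 0)
          + ∑ m ∈ Finset.range (M + 1), if P m then g m else 0 := by
    intro P _ f g
    rw [← Finset.sum_add_distrib]
    exact Finset.sum_congr rfl (fun m _ => by split_ifs <;> simp)
  rw [hs (fun m => 1 ≤ m ∧ m < n), hs (fun m => n + 1 ≤ m), hs (fun m => 1 ≤ m)]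
  ring
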